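/- Let p ≥ 4 be an integer and set t = (p−1)(p−2)/2 (the binomial coefficient C(p−1,2)). Then there exists a finite connected simple graph G such that χ_rlid(G) = p and χ_rlid(G/R) = p + t, where G/R is the maximal twin-free induced subgraph of G; in particular χ_rlid(G) = χ_rlid(G/R) − t and t = t(G), so the lower bound χ_rlid(G/R) − t(G) ≤ χ_rlid(G) is tight. -/

import Mathlib

open SimpleGraph Set

variable {V : Type*}

/-- The closed neighborhood of a vertex. -/
def closedNbhd (G : SimpleGraph V) (v : V) : Set V := insert v (G.neighborSet v)

/-- A (not necessarily proper) coloring `c : V → Fin k` is a relaxed locally identifying coloring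
(rlid-coloring) if any two adjacent vertices with distinct closed neighborhoods receive distinct
sets of colors on their closed neighborhoods. -/
def IsRlidColoring (G : SimpleGraph V) {k : ℕ} (c : V → Fin k) : Prop :=
  ∀ u v : V, G.Adj u v → closedNbhd G u ≠ closedNbhd G v →
    c '' closedNbhd G u ≠ c '' closedNbhd G v

/-- The relaxed locally identifying chromatic number: the least `k` such that `G` admits an
rlid-coloring with `k` colors. -/
noncomputable def rlidChromNum (G : SimpleGraph V) : ℕ :=
  sInf {k : ℕ | ∃ c : V → Fin k, IsRlidColoring G c}

/-- A graph is twin-free if distinct vertices have distinct closed neighborhoods. -/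
def TwinFree (G : SimpleGraph V) : Prop :=
  ∀ u v : V, closedNbhd G u = closedNbhd G v → u = v

/-- `T` is a set of representatives of the twin equivalence relation
(`u R v ↔ N[u] = N[v]`): it contains exactly one vertex from each equivalence class.
The induced subgraph `G.induce T` is then the maximal twin-free induced subgraph `G/R`. -/
def IsTwinRepSet (G : SimpleGraph V) (T : Set V) : Prop :=
  ∀ v : V, ∃! t, t ∈ T ∧ closedNbhd G v = closedNbhd G t

/-- The number `t(G)` of twin-equivalence classes of `G` having at least two vertices. -/
noncomputable def numBigTwinClasses (G : SimpleGraph V) : ℕ :=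
  Nat.card {s : Set V // (∃ v, s = {u | closedNbhd G u = closedNbhd G v}) ∧ ¬ s.Subsingleton}

namespace RlidTight

/-! ### Blow-ups -/

section Blow
variable {Q K : Type} (H : SimpleGraph Q) (s : Q → Set K)

/-- Colours seen from a vertex, when vertices carry sets of colours. -/
def Seen {Q K : Type} (H : SimpleGraph Q) (f : Q → Set K) (a : Q) : Set K :=
  {x | ∃ q, q ∈ closedNbhd H a ∧ x ∈ f q}

/-- Vertices of the blow-up. -/
abbrev BV {Q K : Type} (s : Q → Set K) : Type := {x : Q × K // x.2 ∈ s x.1}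

/-- The blow-up: each vertex `q` becomes a clique indexed by `s q`. -/
def blow {Q K : Type} (H : SimpleGraph Q) (s : Q → Set K) : SimpleGraph (BV s) where
  Adj a b := a ≠ b ∧ (a.1.1 = b.1.1 ∨ H.Adj a.1.1 b.1.1)
  symm := ⟨fun a b h => ⟨h.1.symm, h.2.imp Eq.symm SimpleGraph.Adj.symm⟩⟩
  loopless := ⟨fun a h => h.1 rfl⟩

theorem mem_cn {V : Type*} (G : SimpleGraph V) (u v : V) :
    u ∈ closedNbhd G v ↔ u = v ∨ G.Adj v u := by
  simp [closedNbhd]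

theorem mem_cn_blow (u v : BV s) :
    u ∈ closedNbhd (blow H s) v ↔ u.1.1 ∈ closedNbhd H v.1.1 := by
  rw [mem_cn, mem_cn]
  constructor
  · rintro (rfl | ⟨-, h | h⟩)
    · exact Or.inl rfl
    · exact Or.inl h.symm
    · exact Or.inr h
  · intro h
    by_cases e : u = v
    · exact Or.inl e
    · exact Or.inr ⟨fun h => e h.symm, h.imp Eq.symm id⟩

variable {H s}

theorem cn_blow_eq (htf : TwinFree H) (hs : ∀ q, (s q).Nonempty) (u v : BV s) :
    closedNbhd (blow H s) u = closedNbhd (blow H s) v ↔ u.1.1 = v.1.1 := by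
  constructor
  · intro h
    apply htf
    ext q
    obtain ⟨k, hk⟩ := hs q
    have := Set.ext_iff.1 h ⟨(q, k), hk⟩
    rwa [mem_cn_blow, mem_cn_blow] at this
  · intro h
    ext w
    rw [mem_cn_blow, mem_cn_blow, h]

theorem image_cn_blow {L : Type} (c : BV s → L) (v : BV s) :
    c '' closedNbhd (blow H s) v =
      Seen H (fun q => {x | ∃ u : BV s, u.1.1 = q ∧ c u = x}) v.1.1 := by
  ext x
  constructor
  · rintro ⟨u, hu, rfl⟩
    exact ⟨u.1.1, (mem_cn_blow H s _ _).1 hu, u, rfl, rfl⟩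
  · rintro ⟨q, hq, u, rfl, rfl⟩
    exact ⟨u, (mem_cn_blow H s _ _).2 hq, rfl⟩

theorem image_cn {L : Type} (c : Q → L) (v : Q) :
    c '' closedNbhd H v = Seen H (fun q => {c q}) v := by
  ext x
  constructor
  · rintro ⟨u, hu, rfl⟩
    exact ⟨u, hu, rfl⟩
  · rintro ⟨q, hq, rfl⟩
    exact ⟨q, hq, rfl⟩

theorem twinFree_of_seen (h : ∀ a b, H.Adj a b → Seen H s a ≠ Seen H s b) : TwinFree H := by
  intro a b hab
  by_contra hne
  have h1 : b ∈ closedNbhd H a := by rw [hab, mem_cn]; exact Or.inl rfl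
  rw [mem_cn] at h1
  refine h a b (h1.resolve_left fun e => hne e.symm) ?_
  simp only [Seen, hab]

theorem blow_connected (hc : H.Connected) (hs : ∀ q, (s q).Nonempty) :
    (blow H s).Connected := by
  have key : ∀ a b, H.Reachable a b → ∀ i (hi : i ∈ s a) j (hj : j ∈ s b),
      (blow H s).Reachable ⟨(a, i), hi⟩ ⟨(b, j), hj⟩ := by
    rintro a b ⟨w⟩
    induction w with
    | nil =>
      intro i hi j hj
      by_cases e : i = j
      · subst e; rfl
      · exact SimpleGraph.Adj.reachable ⟨by simpa using e, Or.inl rfl⟩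
    | cons hadj w ih =>
      intro i hi j hj
      obtain ⟨k, hk⟩ := hs _
      refine SimpleGraph.Reachable.trans (SimpleGraph.Adj.reachable ⟨?_, Or.inr hadj⟩)
        (ih k hk j hj)
      intro e
      exact hadj.ne (congrArg (fun x : BV s => x.1.1) e)
  obtain ⟨q⟩ := hc.nonempty
  obtain ⟨k, hk⟩ := hs q
  have : Nonempty (BV s) := ⟨⟨(q, k), hk⟩⟩
  exact ⟨fun u v => key _ _ (hc.preconnected u.1.1 v.1.1) _ u.2 _ v.2⟩

theorem rep_exists (htf : TwinFree H) (hs : ∀ q, (s q).Nonempty) :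
    ∃ T : Set (BV s), IsTwinRepSet (blow H s) T := by
  choose f hf using hs
  refine ⟨{v | v.1.2 = f v.1.1}, fun v => ⟨⟨(v.1.1, f v.1.1), hf _⟩, ⟨rfl, ?_⟩, ?_⟩⟩
  · rw [cn_blow_eq htf (fun q => ⟨_, hf q⟩)]
  · rintro ⟨⟨q, k⟩, hk⟩ ⟨h1, h2⟩
    rw [cn_blow_eq htf (fun q => ⟨_, hf q⟩)] at h2
    simp only [Set.mem_ofPred_eq] at h1 h2
    subst h1 h2
    rfl

theorem rlid_iso {A B : Type} {G : SimpleGraph A} {G' : SimpleGraph B} (e : G ≃g G') {k : ℕ}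
    (h : ∃ c : B → Fin k, IsRlidColoring G' c) : ∃ c : A → Fin k, IsRlidColoring G c := by
  obtain ⟨c, hc⟩ := h
  have hN : ∀ v, closedNbhd G' (e v) = e '' closedNbhd G v := by
    intro v
    ext w
    obtain ⟨w, rfl⟩ := e.surjective w
    rw [e.injective.mem_set_image, mem_cn, mem_cn, e.map_adj_iff, e.injective.eq_iff]
  refine ⟨c ∘ e, fun u v huv hne => ?_⟩
  rw [Set.image_comp, Set.image_comp, ← hN, ← hN]
  refine hc _ _ (e.map_adj_iff.2 huv) ?_
  rw [hN, hN]
  exact fun h => hne (e.injective.image_injective h)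

theorem rlidChromNum_iso {A B : Type} {G : SimpleGraph A} {G' : SimpleGraph B} (e : G ≃g G') :
    rlidChromNum G = rlidChromNum G' := by
  unfold rlidChromNum
  congr 1
  ext k
  exact ⟨rlid_iso e.symm, rlid_iso e⟩

theorem induce_rep (htf : TwinFree H) (hs : ∀ q, (s q).Nonempty) (T : Set (BV s))
    (hT : IsTwinRepSet (blow H s) T) : rlidChromNum ((blow H s).induce T) = rlidChromNum H := by
  have hinj : ∀ a b : T, a.1.1.1 = b.1.1.1 → a = b := by
    intro a b hab
    obtain ⟨t, -, ht⟩ := hT a.1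
    have h1 := ht a.1 ⟨a.2, rfl⟩
    have h2 := ht b.1 ⟨b.2, (cn_blow_eq htf hs _ _).2 hab⟩
    exact Subtype.ext (h1.trans h2.symm)
  have hbij : Function.Bijective (fun a : T => a.1.1.1) := by
    refine ⟨fun a b => hinj a b, fun q => ?_⟩
    obtain ⟨k, hk⟩ := hs q
    obtain ⟨t, ⟨ht, he⟩, -⟩ := hT ⟨(q, k), hk⟩
    exact ⟨⟨t, ht⟩, ((cn_blow_eq htf hs _ _).1 he).symm⟩
  refine rlidChromNum_iso ⟨Equiv.ofBijective _ hbij, ?_⟩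
  intro a b
  change H.Adj a.1.1.1 b.1.1.1 ↔ a.1 ≠ b.1 ∧ (a.1.1.1 = b.1.1.1 ∨ H.Adj a.1.1.1 b.1.1.1)
  constructor
  · intro h
    exact ⟨fun e => h.ne (by rw [e]), Or.inr h⟩
  · rintro ⟨h1, h2⟩
    exact h2.resolve_left fun e => h1 (congrArg Subtype.val (hinj a b e))

end Blow

/-! ### The concrete graph -/

/-- Core indices: singletons, and pairs avoiding `0`. -/
abbrev Ix (n : ℕ) : Type :=
  {S : Finset (Fin (n + 1)) // S.card = 1 ∨ (S.card = 2 ∧ (0 : Fin (n + 1)) ∉ S)}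

/-- Vertices of the twin-free graph. -/
inductive Q (n : ℕ) : Type
  | core (S : Ix n) : Q n
  | gad (A B : Ix n) (h : ¬ B.1 ⊆ A.1) (b : Bool) : Q n
  | leaf (S : Ix n) (k : Fin (n + 1)) : Q n

/-- Oriented edges. -/
inductive R (n : ℕ) : Q n → Q n → Prop
  | cl (S : Ix n) (k : Fin (n + 1)) : R n (.core S) (.leaf S k)
  | ca (A B : Ix n) (h : ¬ B.1 ⊆ A.1) (b : Bool) : R n (.core A) (.gad A B h b)
  | cb (A B : Ix n) (h : ¬ B.1 ⊆ A.1) : R n (.core B) (.gad A B h true)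
  | gg (A B : Ix n) (h : ¬ B.1 ⊆ A.1) : R n (.gad A B h false) (.gad A B h true)

/-- The twin-free graph. -/
def Hg (n : ℕ) : SimpleGraph (Q n) where
  Adj a b := R n a b ∨ R n b a
  symm := ⟨fun _ _ h => h.symm⟩
  loopless := ⟨fun a h => by rcases h with h | h <;> cases h⟩

/-- A numerical code showing finiteness. -/
def Q.code {n : ℕ} : Q n → Ix n ⊕ (Ix n × Ix n × Bool) ⊕ (Ix n × Fin (n + 1))
  | .core S => .inl S
  | .gad A B _ b => .inr (.inl (A, B, b))
  | .leaf S k => .inr (.inr (S, k))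

instance (n : ℕ) : Finite (Q n) := by
  refine Finite.of_injective (Q.code (n := n)) ?_
  intro a b h
  cases a <;> cases b <;> simp_all [Q.code]

theorem Ix.nonempty {n : ℕ} (S : Ix n) : S.1.Nonempty := by
  rw [← Finset.card_pos]
  rcases S.2 with h | h <;> omega

theorem Ix.anti {n : ℕ} {A B : Ix n} (h : A ≠ B) : ¬ B.1 ⊆ A.1 ∨ ¬ A.1 ⊆ B.1 := by
  by_contra hc
  push Not at hc
  exact h (Subtype.ext (hc.2.antisymm hc.1))

/-- Singleton index. -/
def sg {n : ℕ} (k : Fin (n + 1)) : Ix n := ⟨{k}, Or.inl (by simp)⟩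

theorem sg_inj {n : ℕ} {i j : Fin (n + 1)} (h : sg i = sg j) : i = j := by
  simpa [sg] using h

section Seen
variable {n : ℕ} {K : Type} (f : Q n → Set K)

theorem mem_seen (f : Q n → Set K) (a : Q n) (x : K) :
    x ∈ Seen (Hg n) f a ↔ x ∈ f a ∨ ∃ q, (R n a q ∨ R n q a) ∧ x ∈ f q := by
  simp only [Seen, mem_cn, Set.mem_ofPred_eq]
  constructor
  · rintro ⟨q, rfl | h, hx⟩
    · exact Or.inl hx
    · exact Or.inr ⟨q, h, hx⟩
  · rintro (hx | ⟨q, h, hx⟩)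
    · exact ⟨a, Or.inl rfl, hx⟩
    · exact ⟨q, Or.inr h, hx⟩

theorem seen_leaf (S : Ix n) (k : Fin (n + 1)) (x : K) :
    x ∈ Seen (Hg n) f (.leaf S k) ↔ x ∈ f (.leaf S k) ∨ x ∈ f (.core S) := by
  rw [mem_seen]
  refine or_congr Iff.rfl ⟨?_, fun h => ⟨_, Or.inr (.cl S k), h⟩⟩
  rintro ⟨q, h | h, hx⟩ <;> cases h
  exact hx

theorem seen_false (A B : Ix n) (h : ¬ B.1 ⊆ A.1) (x : K) :
    x ∈ Seen (Hg n) f (.gad A B h false) ↔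
      x ∈ f (.gad A B h false) ∨ x ∈ f (.gad A B h true) ∨ x ∈ f (.core A) := by
  rw [mem_seen]
  refine or_congr Iff.rfl ⟨?_, ?_⟩
  · rintro ⟨q, h | h, hx⟩ <;> cases h
    · exact Or.inl hx
    · exact Or.inr hx
  · rintro (hx | hx)
    · exact ⟨_, Or.inl (.gg A B h), hx⟩
    · exact ⟨_, Or.inr (.ca A B h _), hx⟩

theorem seen_true (A B : Ix n) (h : ¬ B.1 ⊆ A.1) (x : K) :
    x ∈ Seen (Hg n) f (.gad A B h true) ↔
      (x ∈ f (.gad A B h false) ∨ x ∈ f (.gad A B h true) ∨ x ∈ f (.core A)) ∨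
        x ∈ f (.core B) := by
  rw [mem_seen]
  constructor
  · rintro (hx | ⟨q, h | h, hx⟩)
    · exact Or.inl (Or.inr (Or.inl hx))
    · cases h
    · cases h
      · exact Or.inl (Or.inr (Or.inr hx))
      · exact Or.inr hx
      · exact Or.inl (Or.inl hx)
  · rintro ((hx | hx | hx) | hx)
    · exact Or.inr ⟨_, Or.inr (.gg A B h), hx⟩
    · exact Or.inl hx
    · exact Or.inr ⟨_, Or.inr (.ca A B h _), hx⟩
    · exact Or.inr ⟨_, Or.inr (.cb A B h), hx⟩

/-- Sufficient condition for a set-colouring to separate adjacent vertices. -/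
theorem seen_ne
    (h1 : ∀ A B : Ix n, ¬ B.1 ⊆ A.1 → ∃ x ∈ f (.core B), x ∉ f (.core A))
    (h2 : ∀ A B h b, f (.gad A B h b) ⊆ f (.core A))
    (h3 : ∀ S A B : Ix n, ∃ k, ∃ x ∈ f (.leaf S k), x ∉ f (.core A) ∧ x ∉ f (.core B))
    (h4 : ∀ S k, ∃ k', ∃ x ∈ f (.leaf S k'), x ∉ f (.core S) ∧ x ∉ f (.leaf S k)) :
    ∀ a b, (Hg n).Adj a b → Seen (Hg n) f a ≠ Seen (Hg n) f b := by
  have hcore : ∀ S k x, x ∈ f (.leaf S k) → x ∈ Seen (Hg n) f (.core S) := by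
    intro S k x hx
    rw [mem_seen]
    exact Or.inr ⟨_, Or.inl (.cl S k), hx⟩
  have hgad : ∀ A B h b x, x ∈ Seen (Hg n) f (.gad A B h b) →
      x ∈ f (.core A) ∨ x ∈ f (.core B) := by
    intro A B h b x hx
    cases b
    · rw [seen_false] at hx
      rcases hx with hx | hx | hx
      · exact Or.inl (h2 _ _ _ _ hx)
      · exact Or.inl (h2 _ _ _ _ hx)
      · exact Or.inl hx
    · rw [seen_true] at hx
      rcases hx with (hx | hx | hx) | hx
      · exact Or.inl (h2 _ _ _ _ hx)
      · exact Or.inl (h2 _ _ _ _ hx)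
      · exact Or.inl hx
      · exact Or.inr hx
  have hcg : ∀ S A B h b, Seen (Hg n) f (.core S) ≠ Seen (Hg n) f (.gad A B h b) := by
    intro S A B h b e
    obtain ⟨k, x, hx, hA, hB⟩ := h3 S A B
    have := hcore S k x hx
    rw [e] at this
    exact (hgad _ _ _ _ _ this).elim hA hB
  have key : ∀ a b, R n a b → Seen (Hg n) f a ≠ Seen (Hg n) f b := by
    intro a b h
    cases h with
    | cl S k =>
      intro e
      obtain ⟨k', x, hx, hA, hB⟩ := h4 S k
      have := hcore S k' x hx
      rw [e, seen_leaf] at this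
      exact this.elim hB hA
    | ca A B h b => exact hcg _ _ _ _ _
    | cb A B h => exact hcg _ _ _ _ _
    | gg A B h =>
      intro e
      obtain ⟨x, hx, hA⟩ := h1 A B h
      have : x ∈ Seen (Hg n) f (.gad A B h true) := by rw [seen_true]; exact Or.inr hx
      rw [← e, seen_false] at this
      rcases this with hx | hx | hx
      · exact hA (h2 _ _ _ _ hx)
      · exact hA (h2 _ _ _ _ hx)
      · exact hA hx
  rintro a b (h | h)
  · exact key a b h
  · exact (key b a h).symm

theorem seen_eq (A B : Ix n) (h : ¬ B.1 ⊆ A.1) (hf : f (.core B) ⊆ f (.core A)) :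
    Seen (Hg n) f (.gad A B h false) = Seen (Hg n) f (.gad A B h true) := by
  ext x
  rw [seen_false, seen_true]
  have := @hf x
  tauto

end Seen

theorem Hg_connected (n : ℕ) : (Hg n).Connected := by
  have hcore : ∀ A B : Ix n, (Hg n).Reachable (.core A) (.core B) := by
    have key : ∀ A B : Ix n, ¬ B.1 ⊆ A.1 → (Hg n).Reachable (.core A) (.core B) := by
      intro A B h
      have e1 : (Hg n).Adj (.core A) (.gad A B h true) := Or.inl (.ca A B h true)
      have e2 : (Hg n).Adj (.core B) (.gad A B h true) := Or.inl (.cb A B h)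
      exact e1.reachable.trans e2.symm.reachable
    intro A B
    by_cases e : A = B
    · rw [e]
    · rcases Ix.anti e with h | h
      · exact key A B h
      · exact (key B A h).symm
  have hall : ∀ q : Q n, ∃ A, (Hg n).Reachable q (.core A) := by
    intro q
    cases q with
    | core S => exact ⟨S, SimpleGraph.Reachable.refl _⟩
    | gad A B h b =>
      have e1 : (Hg n).Adj (.gad A B h b) (.core A) := Or.inr (.ca A B h b)
      exact ⟨A, e1.reachable⟩
    | leaf S k =>
      have e1 : (Hg n).Adj (.leaf S k) (.core S) := Or.inr (.cl S k)
      exact ⟨S, e1.reachable⟩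
  have : Nonempty (Q n) := ⟨.core (sg 0)⟩
  refine ⟨fun a b => ?_⟩
  obtain ⟨A, hA⟩ := hall a
  obtain ⟨B, hB⟩ := hall b
  exact (hA.trans (hcore A B)).trans hB.symm

/-- The colour sets used in the blow-up. -/
noncomputable def s (n : ℕ) : Q n → Set (Fin (n + 1))
  | .core S => {i | i ∈ S.1}
  | .gad A _ _ _ => {A.nonempty.choose}
  | .leaf _ k => {k}

theorem s_nonempty (n : ℕ) (q : Q n) : (s n q).Nonempty := by
  cases q with
  | core S => exact S.nonempty
  | gad A B h b => exact Set.singleton_nonempty _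
  | leaf S k => exact Set.singleton_nonempty _

theorem exists_not_mem {n : ℕ} (S : Finset (Fin (n + 1))) (h : S.card ≤ n) : ∃ x, x ∉ S := by
  by_contra hc
  push Not at hc
  have : S = Finset.univ := Finset.eq_univ_iff_forall.2 hc
  rw [this, Finset.card_univ, Fintype.card_fin] at h
  omega

theorem Ix.card_le {n : ℕ} (S : Ix n) : S.1.card ≤ 2 := by
  rcases S.2 with h | h <;> omega

theorem s_seen (n : ℕ) (hn : 3 ≤ n) :
    ∀ a b, (Hg n).Adj a b → Seen (Hg n) (s n) a ≠ Seen (Hg n) (s n) b := by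
  apply seen_ne
  · intro A B h
    exact Finset.not_subset.1 h
  · rintro A B h b x rfl
    exact A.nonempty.choose_spec
  · intro S A B
    have : ∃ x, x ∉ A.1 ∪ B.1 := by
      rcases A.2 with hA | hA
      · apply exists_not_mem
        have := Finset.card_union_le A.1 B.1
        have := B.card_le
        omega
      · rcases B.2 with hB | hB
        · apply exists_not_mem
          have := Finset.card_union_le A.1 B.1
          omega
        · exact ⟨0, by simp [hA.2, hB.2]⟩
    obtain ⟨x, hx⟩ := this
    rw [Finset.mem_union, not_or] at hx
    exact ⟨x, x, rfl, hx.1, hx.2⟩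
  · intro S k
    obtain ⟨x, hx⟩ := exists_not_mem (S.1 ∪ {k}) (by
      have := Finset.card_union_le S.1 {k}
      have := S.card_le
      simp only [Finset.card_singleton] at *
      omega)
    rw [Finset.mem_union, not_or, Finset.mem_singleton] at hx
    exact ⟨x, x, rfl, hx.1, hx.2⟩

theorem card_Ix (n : ℕ) : Fintype.card (Ix n) = n + 1 + n.choose 2 := by
  rw [Fintype.card_subtype]
  have : (Finset.univ.filter fun S : Finset (Fin (n + 1)) =>
      S.card = 1 ∨ (S.card = 2 ∧ (0 : Fin (n + 1)) ∉ S)) =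
      Finset.powersetCard 1 Finset.univ ∪ Finset.powersetCard 2 (Finset.univ.erase 0) := by
    ext S
    simp only [Finset.mem_filter, Finset.mem_univ, true_and, Finset.mem_union,
      Finset.mem_powersetCard, Finset.subset_univ, Finset.subset_erase]
    tauto
  rw [this, Finset.card_union_of_disjoint]
  · simp
  · rw [Finset.disjoint_left]
    intro S h1 h2
    rw [Finset.mem_powersetCard] at h1 h2
    omega

/-- Colouring of the twin-free graph by core indices. -/
def cH (n : ℕ) : Q n → Ix n
  | .core S => S
  | .gad A _ _ _ => A
  | .leaf _ k => sg k

theorem exists_sg_ne {n : ℕ} (hn : 3 ≤ n) (A B : Ix n) : ∃ k, sg k ≠ A ∧ sg k ≠ B := by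
  by_contra hc
  push Not at hc
  have h0 := hc ⟨0, by omega⟩
  have h1 := hc ⟨1, by omega⟩
  have h2 := hc ⟨2, by omega⟩
  have hne : ∀ i j : Fin (n + 1), i ≠ j → sg i ≠ sg j := fun i j h e => h (sg_inj e)
  have n01 := hne ⟨0, by omega⟩ ⟨1, by omega⟩ (by simp)
  have n02 := hne ⟨0, by omega⟩ ⟨2, by omega⟩ (by simp)
  have n12 := hne ⟨1, by omega⟩ ⟨2, by omega⟩ (by simp)
  generalize sg (⟨0, by omega⟩ : Fin (n + 1)) = x at *
  generalize sg (⟨1, by omega⟩ : Fin (n + 1)) = y at *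
  generalize sg (⟨2, by omega⟩ : Fin (n + 1)) = z at *
  clear hc hne
  by_cases hx : x = A
  · have hy := h1 fun e => n01 (hx.trans e.symm)
    have hz := h2 fun e => n02 (hx.trans e.symm)
    exact n12 (hy.trans hz.symm)
  · have hxB := h0 hx
    by_cases hy : y = A
    · have hz := h2 fun e => n12 (hy.trans e.symm)
      exact n02 (hxB.trans hz.symm)
    · exact n01 (hxB.trans (h1 hy).symm)

theorem cH_seen (n : ℕ) (hn : 3 ≤ n) : ∀ a b, (Hg n).Adj a b →
    Seen (Hg n) (fun q => {cH n q}) a ≠ Seen (Hg n) (fun q => {cH n q}) b := by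
  apply seen_ne
  · intro A B h
    refine ⟨B, rfl, ?_⟩
    rintro (e : B = A)
    exact h (by rw [e])
  · rintro A B h b x rfl
    rfl
  · intro S A B
    obtain ⟨k, h1, h2⟩ := exists_sg_ne hn A B
    exact ⟨k, sg k, rfl, h1, h2⟩
  · intro S k
    obtain ⟨k', h1, h2⟩ := exists_sg_ne hn S (sg k)
    exact ⟨k', sg k', rfl, h1, h2⟩

theorem Hg_twinFree (n : ℕ) (hn : 3 ≤ n) : TwinFree (Hg n) := twinFree_of_seen (s_seen n hn)

theorem chrom_H (n : ℕ) (hn : 3 ≤ n) : rlidChromNum (Hg n) = n + 1 + n.choose 2 := by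
  apply le_antisymm
  · apply Nat.sInf_le
    let e : Ix n ≃ Fin (n + 1 + n.choose 2) := Fintype.equivFinOfCardEq (card_Ix n)
    refine ⟨fun q => e (cH n q), fun u v huv _ h => cH_seen n hn u v huv ?_⟩
    rw [← image_cn, ← image_cn]
    apply e.injective.image_injective
    rw [← Set.image_comp, ← Set.image_comp]
    exact h
  · apply le_csInf
    · let e : Ix n ≃ Fin (n + 1 + n.choose 2) := Fintype.equivFinOfCardEq (card_Ix n)
      refine ⟨_, fun q => e (cH n q), fun u v huv _ h => cH_seen n hn u v huv ?_⟩
      rw [← image_cn, ← image_cn]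
      apply e.injective.image_injective
      rw [← Set.image_comp, ← Set.image_comp]
      exact h
    · rintro k ⟨c, hc⟩
      have key : ∀ A B : Ix n, ¬ B.1 ⊆ A.1 → c (.core A) ≠ c (.core B) := by
        intro A B h e
        have hadj : (Hg n).Adj (.gad A B h false) (.gad A B h true) := Or.inl (.gg A B h)
        refine hc _ _ hadj (fun e => ?_) ?_
        · exact hadj.ne (Hg_twinFree n hn _ _ e)
        · rw [image_cn, image_cn]
          apply seen_eq
          rw [e]
      have hinj : Function.Injective fun A : Ix n => c (.core A) := by
        intro A B e
        by_contra hne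
        rcases Ix.anti hne with h | h
        · exact key A B h e
        · exact key B A h e.symm
      have := Fintype.card_le_of_injective _ hinj
      rwa [card_Ix, Fintype.card_fin] at this

/-- The final graph. -/
noncomputable abbrev Gg (n : ℕ) : SimpleGraph (BV (s n)) := blow (Hg n) (s n)

theorem Gg_coloring (n : ℕ) (hn : 3 ≤ n) :
    ∃ c : BV (s n) → Fin (n + 1), IsRlidColoring (Gg n) c := by
  have himg : ∀ v : BV (s n), (fun v : BV (s n) => v.1.2) '' closedNbhd (Gg n) v =
      Seen (Hg n) (s n) v.1.1 := by
    intro v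
    rw [image_cn_blow]
    congr 1
    ext q x
    constructor
    · rintro ⟨u, rfl, rfl⟩
      exact u.2
    · intro hx
      exact ⟨⟨(q, x), hx⟩, rfl, rfl⟩
  refine ⟨fun v => v.1.2, fun u v huv hne => ?_⟩
  rw [himg, himg]
  rcases huv with ⟨-, h | h⟩
  · exact absurd ((cn_blow_eq (Hg_twinFree n hn) (s_nonempty n) _ _).2 h) hne
  · exact s_seen n hn _ _ h

theorem chrom_G (n : ℕ) (hn : 3 ≤ n) : rlidChromNum (Gg n) = n + 1 := by
  apply le_antisymm
  · exact Nat.sInf_le (Gg_coloring n hn)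
  · refine le_csInf (s := {k : ℕ | ∃ c : BV (s n) → Fin k, IsRlidColoring (Gg n) c})
      ⟨_, Gg_coloring n hn⟩ ?_
    rintro k ⟨c, hc⟩
    let w : Fin (n + 1) → BV (s n) := fun i => ⟨(.core (sg i), i), by simp [s, sg]⟩
    have hw : ∀ i (u : BV (s n)), u.1.1 = .core (sg i) → u = w i := by
      rintro i ⟨⟨q, j⟩, hj⟩ h
      simp only at h
      subst h
      have : j = i := by simpa [s, sg] using hj
      subst this
      rfl
    have hinj : Function.Injective fun i => c (w i) := by
      intro i j e
      by_contra hne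
      have h : ¬ (sg j).1 ⊆ (sg i).1 := by
        simp only [sg, Finset.singleton_subset_iff, Finset.mem_singleton]
        exact fun e => hne e.symm
      obtain ⟨x, hx⟩ := s_nonempty n (.gad (sg i) (sg j) h false)
      obtain ⟨y, hy⟩ := s_nonempty n (.gad (sg i) (sg j) h true)
      have hadj : (Hg n).Adj (.gad (sg i) (sg j) h false) (.gad (sg i) (sg j) h true) :=
        Or.inl (.gg _ _ h)
      refine hc ⟨(_, x), hx⟩ ⟨(_, y), hy⟩ ⟨?_, Or.inr hadj⟩ ?_ ?_
      · intro e
        exact hadj.ne (congrArg (fun x : BV (s n) => x.1.1) e)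
      · rw [Ne, cn_blow_eq (Hg_twinFree n hn) (s_nonempty n)]
        exact hadj.ne
      · rw [image_cn_blow, image_cn_blow]
        apply seen_eq
        rintro z ⟨u, hu, rfl⟩
        rw [hw j u hu]
        exact ⟨w i, rfl, e⟩
    have := Fintype.card_le_of_injective _ hinj
    simpa using this

theorem numBig (n : ℕ) (hn : 3 ≤ n) : numBigTwinClasses (Gg n) = n.choose 2 := by
  have htf := cn_blow_eq (Hg_twinFree n hn) (s_nonempty n)
  have hcl : ∀ v : BV (s n), {u | closedNbhd (Gg n) u = closedNbhd (Gg n) v} =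
      {u : BV (s n) | u.1.1 = v.1.1} := by
    intro v
    ext u
    exact htf u v
  let P := {S : Finset (Fin (n + 1)) // S ∈ Finset.powersetCard 2 (Finset.univ.erase 0)}
  have hP : Nat.card P = n.choose 2 := by
    rw [Nat.card_eq_fintype_card, Fintype.card_coe, Finset.card_powersetCard,
      Finset.card_erase_of_mem (Finset.mem_univ _), Finset.card_univ, Fintype.card_fin,
      Nat.add_sub_cancel]
  have toIx : ∀ S : P, S.1.card = 1 ∨ (S.1.card = 2 ∧ (0 : Fin (n + 1)) ∉ S.1) := by
    intro S
    have := S.2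
    rw [Finset.mem_powersetCard, Finset.subset_erase] at this
    exact Or.inr ⟨this.2, this.1.2⟩
  let I : P → Ix n := fun S => ⟨S.1, toIx S⟩
  rw [← hP]
  unfold numBigTwinClasses
  symm
  let F : P → {t : Set (BV (s n)) // (∃ v, t = {u | closedNbhd (Gg n) u = closedNbhd (Gg n) v}) ∧
      ¬ t.Subsingleton} := fun S => ⟨{u | u.1.1 = .core (I S)}, by
    obtain ⟨a, b, hab, hS⟩ := Finset.card_eq_two.1 (Finset.mem_powersetCard.1 S.2).2
    have ha : a ∈ s n (.core (I S)) := by simp [s, I, hS]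
    have hb : b ∈ s n (.core (I S)) := by simp [s, I, hS]
    refine ⟨⟨⟨(_, a), ha⟩, (hcl ⟨(_, a), ha⟩).symm⟩, fun h => hab ?_⟩
    have := @h ⟨(_, a), ha⟩ rfl ⟨(_, b), hb⟩ rfl
    simpa using this⟩
  refine Nat.card_congr (Equiv.ofBijective F ⟨?_, ?_⟩)
  · intro S S' e
    have e' := congrArg Subtype.val e
    obtain ⟨x, hx⟩ := s_nonempty n (.core (I S))
    have : (⟨(_, x), hx⟩ : BV (s n)) ∈ {u : BV (s n) | u.1.1 = .core (I S')} := by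
      have e2 : {u : BV (s n) | u.1.1 = .core (I S)} = {u : BV (s n) | u.1.1 = .core (I S')} := e'
      rw [← e2]
      rfl
    have h2 : (Q.core (I S)) = .core (I S') := this
    injection h2 with h2
    exact Subtype.ext (congrArg (fun x : Ix n => x.1) h2)
  · rintro ⟨t, ⟨v, rfl⟩, ht⟩
    have hns : ¬ (s n v.1.1).Subsingleton := by
      intro hss
      apply ht
      rw [hcl]
      rintro ⟨⟨q, a⟩, ha⟩ h1 ⟨⟨q', b⟩, hb⟩ h2
      simp only [Set.mem_ofPred_eq] at h1 h2
      subst h1 h2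
      have := hss ha hb
      simp only at this
      subst this
      rfl
    have : ∃ S : P, v.1.1 = .core (I S) := by
      rcases hv : v.1.1 with S | ⟨A, B, h, b⟩ | ⟨S, k⟩
      · rw [hv] at hns
        rcases S.2 with h1 | h1
        · obtain ⟨a, ha⟩ := Finset.card_eq_one.1 h1
          exact absurd (by simp [s, ha]) hns
        · refine ⟨⟨S.1, ?_⟩, rfl⟩
          rw [Finset.mem_powersetCard, Finset.subset_erase]
          exact ⟨⟨Finset.subset_univ _, h1.2⟩, h1.1⟩
      · rw [hv] at hns
        exact absurd Set.subsingleton_singleton hns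
      · rw [hv] at hns
        exact absurd Set.subsingleton_singleton hns
    obtain ⟨S, hS⟩ := this
    refine ⟨S, Subtype.ext ?_⟩
    change {u : BV (s n) | u.1.1 = .core (I S)} =
      {u | closedNbhd (Gg n) u = closedNbhd (Gg n) v}
    rw [hcl, hS]

end RlidTight

/-- For every `p ≥ 4`, with `t = C(p−1, 2) = (p−1)(p−2)/2`, there is a finite
connected graph `G` with `χ_rlid(G) = p`, `t(G) = t` and `χ_rlid(G/R) = p + t`; hence
`χ_rlid(G) = χ_rlid(G/R) − t(G)` and the lower bound of Theorem 1 is tight. -/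
theorem rlid_quotient_lower_bound_tight (p : ℕ) (hp : 4 ≤ p) :
    ∃ (V : Type) (_ : Fintype V) (G : SimpleGraph V),
      G.Connected ∧
      rlidChromNum G = p ∧
      numBigTwinClasses G = (p - 1).choose 2 ∧
      (∃ T : Set V, IsTwinRepSet G T) ∧
      (∀ T : Set V, IsTwinRepSet G T →
        rlidChromNum (G.induce T) = p + (p - 1).choose 2) := by
  obtain ⟨n, rfl⟩ : ∃ n, p = n + 1 := ⟨p - 1, by omega⟩
  have hn : 3 ≤ n := by omega
  have htf := RlidTight.Hg_twinFree n hn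
  have hs := RlidTight.s_nonempty n
  refine ⟨RlidTight.BV (RlidTight.s n), Fintype.ofFinite _, RlidTight.Gg n,
    RlidTight.blow_connected (RlidTight.Hg_connected n) hs, RlidTight.chrom_G n hn,
    RlidTight.numBig n hn, RlidTight.rep_exists htf hs, fun T hT => ?_⟩
  rw [RlidTight.induce_rep htf hs T hT, RlidTight.chrom_H n hn]
  rfl
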